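/- arXiv:2503.12376 — 8 statements merged into one kernel-verified Lean document; each statement's English description precedes it below -/
import Mathlib

section
/- Let n ≥ 1 and d ≥ 1 be natural numbers and set r = C(n−1+d, d). There exist coefficient families c_1, …, c_r : (Fin d → Fin n) → ℝ such that for every k ∈ ℕ and all hermitian complex k×k matrices X_1, …, X_n, one has H_{2d}(X_1, …, X_n) = Σ_{i=1}^r P_i* P_i, where P_i = Σ_{w : Fin d → Fin n} c_i(w) · X_w and P_i* denotes the conjugate transpose. (That is, the noncommutative complete homogeneous symmetric polynomial of degree 2d is a sum of C(n−1+d, d) hermitian squares of homogeneous degree-d noncommutative polynomials.) -/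
open Matrix BigOperators

/-- Product of ring elements along a word `w : Fin d → Fin n`:
`X_{w 0} * X_{w 1} * ⋯ * X_{w (d-1)}`. -/
noncomputable def wordProd {R : Type*} [Monoid R] {n d : ℕ} (X : Fin n → R)
    (w : Fin d → Fin n) : R :=
  (List.ofFn fun i => X (w i)).prod

/-- Number of occurrences of the letter `j` in the word `w`. -/
def letterCount {n d : ℕ} (w : Fin d → Fin n) (j : Fin n) : ℕ :=
  (Finset.univ.filter fun i => w i = j).card

/-- Coefficient of the word `w` in the NCHS polynomial of degree `d`:
`(∏_j k_j(w)!) / d!`. -/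
noncomputable def nchsCoeff {n : ℕ} (d : ℕ) (w : Fin d → Fin n) : ℝ :=
  ((∏ j : Fin n, (letterCount w j).factorial : ℕ) : ℝ) / (d.factorial : ℝ)

/-- The noncommutative complete homogeneous symmetric polynomial of degree `d`
evaluated at `X`. -/
noncomputable def nchs {R : Type*} [Ring R] [Module ℝ R] {n : ℕ} (d : ℕ)
    (X : Fin n → R) : R :=
  ∑ w : Fin d → Fin n, nchsCoeff d w • wordProd X w

/-- Vandermonde form of `(a + b)!`, as a sum of products separating `a` from `b`. -/
lemma add_factorial_eq_sum {a b d : ℕ} (ha : a ≤ d) :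
    (a + b).factorial = ∑ k : Fin (d + 1),
      (a.factorial * a.choose k) * (b.factorial * b.choose k) := by
  have h : (a + b).choose a = ∑ k ∈ Finset.range (d + 1), a.choose k * b.choose k := by
    rw [Nat.add_choose_eq, Finset.Nat.sum_antidiagonal_eq_sum_range_succ_mk,
      ← Finset.sum_range_reflect]
    rw [← Finset.sum_subset (Finset.range_mono (Nat.succ_le_succ ha))]
    · refine Finset.sum_congr rfl fun k hk => ?_
      have hk : k ≤ a := Nat.lt_succ_iff.mp (Finset.mem_range.mp hk)
      simp only [Nat.succ_eq_add_one, Nat.add_sub_cancel]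
      rw [Nat.choose_symm hk, Nat.sub_sub_self hk]
    · intro k _ hk
      rw [Nat.choose_eq_zero_of_lt (by simpa using hk), zero_mul]
  rw [← Nat.add_choose_mul_factorial_mul_factorial a b, ← Nat.choose_symm_add, h, Finset.sum_range, Finset.sum_mul,
    Finset.sum_mul]
  exact Finset.sum_congr rfl fun k _ => by ring

/-- The matrix `∏ j, (α j + β j)! / (2 * d)!`, indexed by multisets of size `d`. -/
noncomputable def nchsGram (n d : ℕ) : Matrix (Sym (Fin n) d) (Sym (Fin n) d) ℝ :=
  Matrix.of fun s t =>
    ((∏ j, (Multiset.count j s.1 + Multiset.count j t.1).factorial : ℕ) : ℝ) /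
      ((2 * d).factorial : ℝ)

lemma nchsGram_posSemidef (n d : ℕ) : (nchsGram n d).PosSemidef := by
  let C : Matrix (Fin n → Fin (d + 1)) (Sym (Fin n) d) ℝ := Matrix.of fun κ s =>
    ∏ j, (((Multiset.count j s.1).factorial * (Multiset.count j s.1).choose (κ j) : ℕ) : ℝ)
  have h : nchsGram n d = ((2 * d).factorial : ℝ)⁻¹ • (Cᴴ * C) := by
    ext s t
    have hs : ∀ j, Multiset.count j s.1 ≤ d := fun j =>
      (Multiset.count_le_card j s.1).trans s.2.le
    simp only [nchsGram, C, Matrix.of_apply, Matrix.smul_apply, Matrix.mul_apply,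
      Matrix.conjTranspose_apply, star_trivial, smul_eq_mul, div_eq_inv_mul]
    congr 1
    simp_rw [add_factorial_eq_sum (hs _), Finset.prod_univ_sum, Fintype.piFinset_univ,
      ← Finset.prod_mul_distrib]
    push_cast
    rfl
  rw [h]
  exact (Matrix.posSemidef_conjTranspose_mul_self C).smul (by positivity)

/-- The multiset of letters of a word. -/
def wordSym {n d : ℕ} (w : Fin d → Fin n) : Sym (Fin n) d :=
  ⟨Finset.univ.val.map w, by simp⟩

lemma count_wordSym {n d : ℕ} (w : Fin d → Fin n) (j : Fin n) :
    Multiset.count j (wordSym w).1 = letterCount w j := by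
  simp only [wordSym, letterCount, Multiset.count_map, Finset.card, Finset.filter_val, eq_comm]

lemma letterCount_append {n d e : ℕ} (u : Fin d → Fin n) (v : Fin e → Fin n) (j : Fin n) :
    letterCount (Fin.append u v) j = letterCount u j + letterCount v j := by
  simp only [letterCount, Finset.card_filter, Fin.sum_univ_add, Fin.append_left, Fin.append_right]

lemma letterCount_comp_rev {n d : ℕ} (w : Fin d → Fin n) (j : Fin n) :
    letterCount (w ∘ Fin.rev) j = letterCount w j := by
  simp only [letterCount, Finset.card_filter]
  exact Equiv.sum_comp Fin.revPerm fun i => if w i = j then 1 else 0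

lemma wordProd_append {R : Type*} [Monoid R] {n d e : ℕ} (X : Fin n → R)
    (u : Fin d → Fin n) (v : Fin e → Fin n) :
    wordProd X (Fin.append u v) = wordProd X u * wordProd X v := by
  simp [wordProd, List.ofFn_add]

lemma wordProd_comp_rev {k n d : ℕ} {X : Fin n → Matrix (Fin k) (Fin k) ℂ}
    (hX : ∀ j, (X j).IsHermitian) (w : Fin d → Fin n) :
    wordProd X (w ∘ Fin.rev) = (wordProd X w)ᴴ := by
  rw [wordProd, wordProd, Matrix.conjTranspose_list_prod, List.map_ofFn]
  have : (Matrix.conjTranspose ∘ fun i => X (w i)) = fun i => X (w i) :=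
    funext fun i => hX (w i)
  rw [this]
  congr 1
  apply List.ext_getElem <;> simp [Fin.rev, Nat.sub_sub, Nat.add_comm]

lemma nchsCoeff_append_rev {n d : ℕ} (u v : Fin d → Fin n) :
    nchsCoeff (d + d) (Fin.append (u ∘ Fin.rev) v) = nchsGram n d (wordSym u) (wordSym v) := by
  simp only [nchsCoeff, nchsGram, Matrix.of_apply, count_wordSym, letterCount_append,
    letterCount_comp_rev, two_mul]

/-- Expansion of `H_{2d}` at hermitian matrices by splitting each word in the middle. -/
lemma nchs_two_mul_eq_sum {k n d : ℕ} {X : Fin n → Matrix (Fin k) (Fin k) ℂ}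
    (hX : ∀ j, (X j).IsHermitian) :
    nchs (2 * d) X = ∑ u : Fin d → Fin n, ∑ v : Fin d → Fin n,
      nchsGram n d (wordSym u) (wordSym v) • ((wordProd X u)ᴴ * wordProd X v) := by
  rw [two_mul, nchs, ← Equiv.sum_comp (Fin.appendEquiv d d), Fintype.sum_prod_type,
    ← Equiv.sum_comp (Equiv.arrowCongr Fin.revPerm (Equiv.refl (Fin n)))]
  refine Finset.sum_congr rfl fun u _ => Finset.sum_congr rfl fun v _ => ?_
  rw [← nchsCoeff_append_rev, ← wordProd_comp_rev hX, ← wordProd_append]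
  rfl

/-- The NCHS polynomial `H_{2d}` is a sum of `C(n-1+d, d)` hermitian squares of
homogeneous degree-`d` noncommutative polynomials. -/
theorem stmt_0 (n d : ℕ) (hn : 1 ≤ n) (hd : 1 ≤ d) :
    ∃ c : Fin ((n - 1 + d).choose d) → (Fin d → Fin n) → ℝ,
      ∀ (k : ℕ) (X : Fin n → Matrix (Fin k) (Fin k) ℂ),
        (∀ j, (X j).IsHermitian) →
        nchs (2 * d) X =
          ∑ i : Fin ((n - 1 + d).choose d),
            (∑ w : Fin d → Fin n, (c i w : ℂ) • wordProd X w)ᴴ *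
              (∑ w : Fin d → Fin n, (c i w : ℂ) • wordProd X w) := by
  obtain ⟨B, hB⟩ : ∃ B, nchsGram n d = Bᴴ * B := by
    open scoped MatrixOrder Matrix.Norms.L2Operator in
    exact CStarAlgebra.nonneg_iff_eq_star_mul_self.mp (nchsGram_posSemidef n d).nonneg
  have hcard : Fintype.card (Sym (Fin n) d) = (n - 1 + d).choose d := by
    rw [Sym.card_sym_eq_choose, Fintype.card_fin, Nat.sub_add_comm hn]
  let e : Fin ((n - 1 + d).choose d) ≃ Sym (Fin n) d := (Fintype.equivFinOfCardEq hcard).symm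
  refine ⟨fun i w => B (e i) (wordSym w), fun k X hX => ?_⟩
  rw [nchs_two_mul_eq_sum hX, Equiv.sum_comp e fun s =>
    (∑ w, (B s (wordSym w) : ℂ) • wordProd X w)ᴴ * ∑ w, (B s (wordSym w) : ℂ) • wordProd X w]
  simp only [Matrix.conjTranspose_sum, Finset.sum_mul_sum]
  symm
  rw [Finset.sum_comm]
  refine Finset.sum_congr rfl fun u _ => ?_
  rw [Finset.sum_comm]
  refine Finset.sum_congr rfl fun v _ => ?_
  rw [hB, Matrix.mul_apply, Finset.sum_smul]
  refine Finset.sum_congr rfl fun s _ => ?_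
  simp [Matrix.conjTranspose_smul, smul_smul, mul_comm, ← Complex.coe_smul]
end

section
/- Let n ≥ 1 and d ≥ 1 be natural numbers. If r ∈ ℕ and c_1, …, c_r : (Fin d → Fin n) → ℝ are coefficient families such that for every k ∈ ℕ and all hermitian complex k×k matrices X_1, …, X_n one has H_{2d}(X_1, …, X_n) = Σ_{i=1}^r P_i* P_i, where P_i = Σ_{w : Fin d → Fin n} c_i(w) · X_w, then r ≥ C(n−1+d, d). (The number C(n−1+d, d) of hermitian squares in a sum-of-hermitian-squares representation of the NCHS polynomial H_{2d} is minimal.) -/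
open Matrix BigOperators

/-- Adjacency matrix of the path `0 - 1 - ⋯ - D`, restricted to the edges labelled `j`, where the
edge from `a` to `a + 1` carries the label `w a`. -/
def pathMatrix {n : ℕ} (D : ℕ) (w : ℕ → Fin n) (j : Fin n) :
    Matrix (Fin (D + 1)) (Fin (D + 1)) ℂ :=
  fun a b => if (b : ℕ) = a + 1 ∧ w a = j ∨ (a : ℕ) = b + 1 ∧ w b = j then 1 else 0

theorem pathMatrix_isHermitian {n : ℕ} (D : ℕ) (w : ℕ → Fin n) (j : Fin n) :
    (pathMatrix D w j).IsHermitian := by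
  ext a b
  rw [Matrix.conjTranspose_apply, pathMatrix, pathMatrix, apply_ite star, star_one, star_zero]
  exact if_congr or_comm rfl rfl

theorem pathMatrix_list_prod_apply {n : ℕ} (D : ℕ) (w : ℕ → Fin n) (l : List (Fin n))
    (a b : Fin (D + 1)) (hab : (a : ℕ) + l.length ≤ b) :
    (l.map (pathMatrix D w)).prod a b =
      if (a : ℕ) + l.length = b ∧ ∀ (i : ℕ) (h : i < l.length), l[i] = w (a + i)
        then 1 else 0 := by
  induction l generalizing a with
  | nil => simp [Matrix.one_apply, Fin.ext_iff]
  | cons j l ih =>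
    simp only [List.length_cons] at hab ⊢
    rw [List.map_cons, List.prod_cons, Matrix.mul_apply]
    have ha : (a : ℕ) + 1 < D + 1 := by omega
    rw [Finset.sum_eq_single ⟨a + 1, ha⟩]
    · rw [ih _ (by simp only; omega)]
      have hX : pathMatrix D w j a ⟨a + 1, ha⟩ = if j = w a then 1 else 0 := by
        simp only [pathMatrix]
        congr 1
        simp only [true_and, eq_iff_iff]
        constructor
        · rintro (h | h)
          · exact h.symm
          · omega
        · exact fun h => Or.inl h.symm
      rw [hX, ite_mul, one_mul, zero_mul, ← ite_and]
      congr 1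
      simp only [eq_iff_iff]
      constructor
      · rintro ⟨h₀, h₁, h₂⟩
        refine ⟨by omega, fun i hi => ?_⟩
        cases i with
        | zero => simpa using h₀
        | succ i =>
          have := h₂ i (by omega)
          rw [List.getElem_cons_succ, this]
          congr 1
          omega
      · rintro ⟨h₁, h₂⟩
        refine ⟨by simpa using h₂ 0 (by omega), by omega, fun i hi => ?_⟩
        have := h₂ (i + 1) (by omega)
        rw [List.getElem_cons_succ] at this
        rw [this]
        congr 1
        omega
    · intro c _ hc
      have hc' : (c : ℕ) ≠ a + 1 := fun h => hc (Fin.ext h)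
      by_cases hca : (a : ℕ) = c + 1
      · rw [ih c (by omega), if_neg (by omega), mul_zero]
      · simp [pathMatrix, hc', hca]
    · simp

theorem pathMatrix_list_prod_zero_last {n : ℕ} [NeZero n] (t l : List (Fin n))
    (hl : l.length = t.length) :
    (l.map (pathMatrix t.length fun i => t.getD i 0)).prod 0 (Fin.last t.length) =
      if l = t then 1 else 0 := by
  rw [pathMatrix_list_prod_apply _ _ _ _ _ (by simp [hl])]
  congr 1
  simp only [Fin.val_zero, zero_add, Fin.val_last, hl, true_and, eq_iff_iff]
  constructor
  · intro h
    refine List.ext_getElem hl fun i h₁ h₂ => ?_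
    rw [h i h₂, List.getD_eq_getElem _ _ h₂]
  · rintro rfl i h
    rw [List.getD_eq_getElem _ _ h]

theorem wordProd_eq_list_prod {R : Type*} [Monoid R] {n d : ℕ} (X : Fin n → R)
    (w : Fin d → Fin n) : wordProd X w = ((List.ofFn w).map X).prod := by
  rw [wordProd, List.map_ofFn]
  rfl

theorem letterCount_eq_count {n d : ℕ} (w : Fin d → Fin n) (j : Fin n) :
    letterCount w j = (List.ofFn w).count j := by
  rw [letterCount, List.ofFn_eq_map, List.count_eq_countP, List.countP_map,
    List.countP_eq_length_filter, ← List.toFinset_card_of_nodup ((List.nodup_finRange d).filter _)]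
  congr 1
  ext i
  simp

theorem exists_ofFn_eq {α : Type*} {d : ℕ} (t : List α) (ht : t.length = d) :
    ∃ w : Fin d → α, List.ofFn w = t := by
  subst ht
  exact ⟨t.get, List.ofFn_get t⟩

theorem nchs_pathMatrix_zero_last {n d : ℕ} [NeZero n] (t : List (Fin n)) (ht : t.length = d) :
    nchs d (pathMatrix t.length fun i => t.getD i 0) 0 (Fin.last t.length) =
      (((∏ j : Fin n, (t.count j).factorial : ℕ) : ℝ) / (d.factorial : ℝ) : ℝ) := by
  obtain ⟨w, hw⟩ := exists_ofFn_eq t ht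
  rw [nchs, Matrix.sum_apply, Finset.sum_eq_single w]
  · rw [Matrix.smul_apply, wordProd_eq_list_prod, pathMatrix_list_prod_zero_last _ _ (by simp [ht]),
      if_pos hw, nchsCoeff]
    simp only [letterCount_eq_count, hw]
    simp
  · intro v _ hv
    rw [Matrix.smul_apply, wordProd_eq_list_prod, pathMatrix_list_prod_zero_last _ _ (by simp [ht]),
      if_neg, smul_zero]
    intro h
    exact hv (List.ofFn_injective (h.trans hw.symm))
  · simp

/-- The coefficients of a sum-of-hermitian-squares representation of `H_{2d}` factor the Gram
matrix `(u, v) ↦ ∏ⱼ (kⱼ(u) + kⱼ(v))! / (2d)!`. -/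
theorem sum_mul_eq_of_nchs_eq_sum_hermitian_squares {n d r : ℕ} [NeZero n]
    (c : Fin r → (Fin d → Fin n) → ℝ)
    (hrep : ∀ (k : ℕ) (X : Fin n → Matrix (Fin k) (Fin k) ℂ),
      (∀ j, (X j).IsHermitian) →
      nchs (2 * d) X =
        ∑ i : Fin r,
          (∑ w : Fin d → Fin n, (c i w : ℂ) • wordProd X w)ᴴ *
            (∑ w : Fin d → Fin n, (c i w : ℂ) • wordProd X w))
    (u v : Fin d → Fin n) :
    ∑ i, c i u * c i v =
      ((∏ j : Fin n, (letterCount u j + letterCount v j).factorial : ℕ) : ℝ) /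
        ((2 * d).factorial : ℝ) := by
  set t : List (Fin n) := (List.ofFn u).reverse ++ List.ofFn v with ht
  have htl : t.length = 2 * d := by simp [ht, two_mul]
  have hX := pathMatrix_isHermitian t.length fun i => t.getD i 0
  have hsq (u' v' : Fin d → Fin n) :
      ((wordProd (pathMatrix t.length fun i => t.getD i 0) u')ᴴ *
        wordProd (pathMatrix t.length fun i => t.getD i 0) v') 0 (Fin.last t.length) =
      if u' = u ∧ v' = v then 1 else 0 := by
    rw [wordProd_eq_list_prod, wordProd_eq_list_prod, Matrix.conjTranspose_list_prod,
      List.map_map, ← List.map_reverse]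
    have hcomp : (conjTranspose ∘ pathMatrix t.length fun i => t.getD i 0) =
        pathMatrix t.length fun i => t.getD i 0 := funext fun j => (hX j).eq
    rw [hcomp, ← List.prod_append, ← List.map_append,
      pathMatrix_list_prod_zero_last _ _ (by simp [htl, two_mul])]
    congr 1
    rw [ht, eq_iff_iff]
    constructor
    · intro h
      obtain ⟨h₁, h₂⟩ := List.append_inj h (by simp)
      exact ⟨List.ofFn_injective (List.reverse_injective h₁), List.ofFn_injective h₂⟩
    · rintro ⟨rfl, rfl⟩
      rfl
  have key := congrFun (congrFun (hrep _ _ hX) 0) (Fin.last t.length)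
  rw [nchs_pathMatrix_zero_last t htl, Matrix.sum_apply] at key
  have hi (i : Fin r) :
      ((∑ w : Fin d → Fin n,
          (c i w : ℂ) • wordProd (pathMatrix t.length fun i => t.getD i 0) w)ᴴ *
        (∑ w : Fin d → Fin n,
          (c i w : ℂ) • wordProd (pathMatrix t.length fun i => t.getD i 0) w)) 0
          (Fin.last t.length) = (c i u * c i v : ℝ) := by
    rw [Matrix.conjTranspose_sum, Finset.sum_mul_sum, Matrix.sum_apply]
    simp only [Matrix.sum_apply, Matrix.conjTranspose_smul, Matrix.smul_mul, Matrix.mul_smul,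
      Matrix.smul_apply, hsq]
    rw [Finset.sum_eq_single u, Finset.sum_eq_single v]
    · simp [mul_comm]
    · intro b _ hb
      simp [hb]
    · simp
    · intro b _ hb
      simp [hb]
    · simp
  rw [Finset.sum_congr rfl fun i _ => hi i, ← Complex.ofReal_sum, Complex.ofReal_inj] at key
  rw [← key]
  simp [ht, letterCount_eq_count]

theorem add_factorial_eq_sum_choose_mul_choose (a b N : ℕ) (hN : a ≤ N) :
    (a + b).factorial =
      ∑ m ∈ Finset.range (N + 1), (a.factorial * a.choose m) * (b.factorial * b.choose m) := by
  have hch : (a + b).choose a = ∑ m ∈ Finset.range (N + 1), a.choose m * b.choose m := by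
    rw [add_comm a b, Nat.add_choose_eq,
      Finset.Nat.sum_antidiagonal_eq_sum_range_succ (fun i j => b.choose i * a.choose j)]
    rw [← Finset.sum_subset (Finset.range_mono (Nat.succ_le_succ hN))]
    · refine Finset.sum_congr rfl fun m hm => ?_
      rw [Nat.choose_symm (Nat.lt_succ_iff.mp (Finset.mem_range.mp hm)), mul_comm]
    · intro m _ hm
      rw [Nat.choose_eq_zero_of_lt (by simpa using hm), zero_mul]
  rw [add_comm a b, ← Nat.add_choose_mul_factorial_mul_factorial, add_comm b a, hch, Finset.sum_mul, Finset.sum_mul]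
  exact Finset.sum_congr rfl fun m _ => by ring

theorem exists_letterCount_eq {n d : ℕ} (s : Sym (Fin n) d) :
    ∃ w : Fin d → Fin n, ∀ j, letterCount w j = (s : Multiset (Fin n)).count j := by
  obtain ⟨w, hw⟩ := exists_ofFn_eq (s : Multiset (Fin n)).toList
    ((Multiset.length_toList _).trans s.2)
  refine ⟨w, fun j => ?_⟩
  rw [letterCount_eq_count, hw, ← Multiset.coe_count, Multiset.coe_toList]

theorem sum_sum_mul_sum_mul {ι κ : Type*} [Fintype ι] (S : Finset κ) (g : ι → ℝ)
    (f : ι → κ → ℝ) :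
    ∑ s, ∑ t, g s * g t * ∑ m ∈ S, f s m * f t m = ∑ m ∈ S, (∑ s, g s * f s m) ^ 2 := by
  simp only [sq, Finset.sum_mul_sum]
  rw [Finset.sum_comm (s := S)]
  refine Finset.sum_congr rfl fun s _ => ?_
  rw [Finset.sum_comm (s := S)]
  refine Finset.sum_congr rfl fun t _ => ?_
  rw [Finset.mul_sum]
  exact Finset.sum_congr rfl fun m _ => by ring

/-- The Gram matrix `(s, t) ↦ ∏ⱼ (sⱼ + tⱼ)!` over multisets of size `d` is positive definite. -/
theorem eq_zero_of_sum_prod_factorial_eq_zero {n d : ℕ} (g : Sym (Fin n) d → ℝ)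
    (hg : ∑ s, ∑ t, g s * g t * ((∏ j : Fin n, ((s : Multiset (Fin n)).count j +
      (t : Multiset (Fin n)).count j).factorial : ℕ) : ℝ) = 0) :
    g = 0 := by
  set f : Sym (Fin n) d → (Fin n → ℕ) → ℝ := fun s m =>
    ∏ j, (((s : Multiset (Fin n)).count j).factorial *
      ((s : Multiset (Fin n)).count j).choose (m j) : ℝ) with hf
  have hsum (s t : Sym (Fin n) d) :
      ((∏ j : Fin n, ((s : Multiset (Fin n)).count j +
        (t : Multiset (Fin n)).count j).factorial : ℕ) : ℝ) =
      ∑ m ∈ Fintype.piFinset fun _ : Fin n => Finset.range (d + 1), f s m * f t m := by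
    have hle (j : Fin n) : (s : Multiset (Fin n)).count j ≤ d :=
      (Multiset.count_le_card _ _).trans_eq s.2
    simp only [fun j => add_factorial_eq_sum_choose_mul_choose _
      ((t : Multiset (Fin n)).count j) d (hle j), hf, ← Finset.prod_mul_distrib]
    push_cast
    rw [Finset.prod_univ_sum]
  have hsq : ∑ m ∈ Fintype.piFinset fun _ : Fin n => Finset.range (d + 1),
      (∑ s, g s * f s m) ^ 2 = 0 := by
    rw [← hg, ← sum_sum_mul_sum_mul]
    simp only [hsum]
  rw [Finset.sum_eq_zero_iff_of_nonneg fun _ _ => sq_nonneg _] at hsq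
  funext s
  have h := hsq (fun j => (s : Multiset (Fin n)).count j) (by
    simp only [Fintype.mem_piFinset, Finset.mem_range, Nat.lt_succ_iff]
    exact fun j => (Multiset.count_le_card _ _).trans_eq s.2)
  rw [sq_eq_zero_iff, Finset.sum_eq_single s] at h
  · refine (mul_eq_zero.mp h).resolve_right ?_
    simp [hf, Finset.prod_eq_zero_iff, Nat.factorial_ne_zero]
  · intro t _ hts
    have hlt : ∃ j, (t : Multiset (Fin n)).count j < (s : Multiset (Fin n)).count j := by
      by_contra! hle
      exact hts (Subtype.ext (Multiset.eq_of_le_of_card_le (Multiset.le_iff_count.mpr hle)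
        (t.2.trans s.2.symm).le).symm)
    obtain ⟨j, hj⟩ := hlt
    refine mul_eq_zero_of_right _ (Finset.prod_eq_zero (Finset.mem_univ j) ?_)
    rw [Nat.choose_eq_zero_of_lt hj, Nat.cast_zero, mul_zero]
  · simp

/-- Minimality: any sum-of-hermitian-squares representation of the NCHS polynomial
`H_{2d}` (with homogeneous degree-`d` squares) uses at least `C(n-1+d, d)` squares. -/
theorem stmt_1 (n d : ℕ) (hn : 1 ≤ n) (hd : 1 ≤ d) (r : ℕ)
    (c : Fin r → (Fin d → Fin n) → ℝ)
    (hrep : ∀ (k : ℕ) (X : Fin n → Matrix (Fin k) (Fin k) ℂ),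
      (∀ j, (X j).IsHermitian) →
      nchs (2 * d) X =
        ∑ i : Fin r,
          (∑ w : Fin d → Fin n, (c i w : ℂ) • wordProd X w)ᴴ *
            (∑ w : Fin d → Fin n, (c i w : ℂ) • wordProd X w)) :
    r ≥ (n - 1 + d).choose d := by
  have : NeZero n := ⟨by omega⟩
  choose W hW using exists_letterCount_eq (n := n) (d := d)
  have hli : LinearIndependent ℝ fun (s : Sym (Fin n) d) (i : Fin r) => c i (W s) := by
    refine Fintype.linearIndependent_iff.mpr fun g hg => ?_
    refine congrFun (eq_zero_of_sum_prod_factorial_eq_zero g ?_)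
    have hgi (i : Fin r) : ∑ s, g s * c i (W s) = 0 := by
      simpa using congrFun hg i
    have hgram (s t : Sym (Fin n) d) :
        ((∏ j : Fin n, ((s : Multiset (Fin n)).count j +
          (t : Multiset (Fin n)).count j).factorial : ℕ) : ℝ) =
        ((2 * d).factorial : ℝ) * ∑ i, c i (W s) * c i (W t) := by
      rw [sum_mul_eq_of_nchs_eq_sum_hermitian_squares c hrep,
        mul_div_cancel₀ _ (Nat.cast_ne_zero.mpr (Nat.factorial_ne_zero _))]
      simp only [hW]
    simp only [hgram, mul_left_comm _ ((2 * d).factorial : ℝ), ← Finset.mul_sum]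
    rw [sum_sum_mul_sum_mul]
    simp [hgi]
  have hcard := hli.fintype_card_le_finrank
  rw [Sym.card_sym_eq_choose, Fintype.card_fin, Module.finrank_fin_fun] at hcard
  rwa [ge_iff_le, show n - 1 + d = n + d - 1 by omega]
end

section
/- Let n ≥ 1 and d ≥ 1 be natural numbers. The matrix G̃_{n,d} is positive definite. -/
open Matrix BigOperators

/-- The matrix `G̃_{n,d}`, indexed by exponent vectors `k : Fin n → ℕ` with
`∑ k = d`, with `(k, l)` entry `(∏ j, (k_j + l_j)!)/(2d)!`. -/
noncomputable def Gtilde (n d : ℕ) :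
    Matrix (Finset.Nat.antidiagonalTuple n d) (Finset.Nat.antidiagonalTuple n d) ℝ :=
  fun k l =>
    ((∏ j : Fin n, ((k : Fin n → ℕ) j + (l : Fin n → ℕ) j).factorial : ℕ) : ℝ) /
      ((2 * d).factorial : ℝ)

/-- A form of Vandermonde's identity, truncated at any bound `d ≥ b`. -/
theorem factorial_add_eq_sum_choose (a b d : ℕ) (hb : b ≤ d) :
    (a + b).factorial =
      ∑ i : Fin (d + 1), (a.factorial * a.choose i) * (b.factorial * b.choose i) := by
  have vandermonde : (a + b).choose b = ∑ i : Fin (d + 1), a.choose i * b.choose i := by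
    rw [Fin.sum_univ_eq_sum_range (fun i => a.choose i * b.choose i), Nat.add_choose_eq,
      Finset.Nat.sum_antidiagonal_eq_sum_range_succ_mk]
    refine (Finset.sum_congr rfl fun i hi => ?_).trans
      (Finset.sum_subset (Finset.range_mono (Nat.succ_le_succ hb)) fun i _ hi => ?_)
    · rw [Nat.choose_symm (Nat.lt_succ_iff.mp (Finset.mem_range.mp hi))]
    · rw [Nat.choose_eq_zero_of_lt (n := b) (by simpa using hi), mul_zero]
  rw [← Nat.add_choose_mul_factorial_mul_factorial, vandermonde,
    Finset.sum_mul, Finset.sum_mul]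
  exact Finset.sum_congr rfl fun i _ => by ring

/-- The factor `A` in the decomposition `(2d)! • G̃_{n,d} = Aᵀ * A`. -/
def factorialChooseMatrix (n d : ℕ) :
    Matrix (Fin n → Fin (d + 1)) (Finset.Nat.antidiagonalTuple n d) ℝ :=
  fun i k => ∏ j, (((k : Fin n → ℕ) j).factorial * ((k : Fin n → ℕ) j).choose (i j) : ℝ)

theorem le_of_mem_antidiagonalTuple {n d : ℕ} {k : Fin n → ℕ}
    (hk : k ∈ Finset.Nat.antidiagonalTuple n d) (j : Fin n) : k j ≤ d := by
  rw [← Finset.Nat.mem_antidiagonalTuple.mp hk]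
  exact Finset.single_le_sum (fun _ _ => Nat.zero_le _) (Finset.mem_univ j)

theorem Gtilde_eq_smul_conjTranspose_mul_self (n d : ℕ) :
    Gtilde n d = ((2 * d).factorial : ℝ)⁻¹ •
      ((factorialChooseMatrix n d)ᴴ * factorialChooseMatrix n d) := by
  ext k l
  simp only [Gtilde, Matrix.smul_apply, Matrix.mul_apply, conjTranspose_apply, star_trivial,
    factorialChooseMatrix, ← Finset.prod_mul_distrib, smul_eq_mul]
  rw [div_eq_inv_mul]
  congr 1
  push_cast
  simp_rw [fun j => factorial_add_eq_sum_choose ((k : Fin n → ℕ) j) ((l : Fin n → ℕ) j) d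
    (le_of_mem_antidiagonalTuple l.2 j)]
  push_cast
  rw [Finset.prod_univ_sum, Fintype.piFinset_univ]

/-- On the rows indexed by exponent vectors of degree `d` the factor is diagonal. -/
theorem factorialChooseMatrix_mulVec_apply {n d : ℕ} (x : Finset.Nat.antidiagonalTuple n d → ℝ)
    (i : Finset.Nat.antidiagonalTuple n d) :
    (factorialChooseMatrix n d *ᵥ x)
        (fun j => ⟨(i : Fin n → ℕ) j, Nat.lt_succ_of_le (le_of_mem_antidiagonalTuple i.2 j)⟩) =
      (∏ j, (((i : Fin n → ℕ) j).factorial : ℝ)) * x i := by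
  rw [mulVec, dotProduct, Finset.sum_eq_single i]
  · simp [factorialChooseMatrix]
  · intro k _ hki
    obtain ⟨j, hj⟩ : ∃ j, (k : Fin n → ℕ) j < (i : Fin n → ℕ) j := by
      by_contra! h
      refine hki (Subtype.ext (funext fun j => ?_))
      have hsum : ∑ j, (i : Fin n → ℕ) j = ∑ j, (k : Fin n → ℕ) j :=
        (Finset.Nat.mem_antidiagonalTuple.mp i.2).trans
          (Finset.Nat.mem_antidiagonalTuple.mp k.2).symm
      exact ((Finset.sum_eq_sum_iff_of_le fun j _ => h j).mp hsum j (Finset.mem_univ j)).symm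
    refine mul_eq_zero_of_left (Finset.prod_eq_zero (Finset.mem_univ j) ?_) _
    simp [Nat.choose_eq_zero_of_lt hj]
  · simp

theorem factorialChooseMatrix_mulVec_injective (n d : ℕ) :
    Function.Injective (factorialChooseMatrix n d).mulVec := by
  intro x y hxy
  funext i
  have h := congrFun hxy
    (fun j => ⟨(i : Fin n → ℕ) j, Nat.lt_succ_of_le (le_of_mem_antidiagonalTuple i.2 j)⟩)
  rw [factorialChooseMatrix_mulVec_apply, factorialChooseMatrix_mulVec_apply] at h
  exact mul_left_cancel₀ (by positivity) h

/-- `G̃_{n,d}` is positive definite. -/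
theorem stmt_6 (n d : ℕ) (hn : 1 ≤ n) (hd : 1 ≤ d) : (Gtilde n d).PosDef := by
  rw [Gtilde_eq_smul_conjTranspose_mul_self]
  exact (PosDef.conjTranspose_mul_self _ (factorialChooseMatrix_mulVec_injective n d)).smul
    (by positivity)
end

section
/- For all real symmetric matrices X_1, X_2 of the same size, the kernel of H_4(X_1, X_2) − (5/12)(X_1^4 + X_2^4) equals ker X_1 ∩ ker X_2. -/
open Matrix BigOperators

/-- A sum over all words of length `d + 1`, split according to the first letter. -/
theorem sum_words_succ {M α : Type*} [AddCommMonoid M] [Fintype α] [DecidableEq α] {d : ℕ}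
    (f : (Fin (d + 1) → α) → M) :
    ∑ w : Fin (d + 1) → α, f w = ∑ a : α, ∑ w : Fin d → α, f (vecCons a w) := by
  rw [← (Fin.consEquiv fun _ : Fin (d + 1) => α).sum_comp, Fintype.sum_prod_type]
  rfl

theorem letterCount_eq_sum {n d : ℕ} (w : Fin d → Fin n) (j : Fin n) :
    letterCount w j = ∑ i, if w i = j then 1 else 0 :=
  Finset.card_filter _ _

/-- The sum of squares representation of `H₄(A, B) - (5/12)(A⁴ + B⁴)`. -/
theorem nchs_four_sub_eq {R : Type*} [Ring R] [Algebra ℝ R] (A B : R) :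
    nchs 4 ![A, B] - (5 / 12 : ℝ) • (A ^ 4 + B ^ 4) =
      (5 / 24 : ℝ) • ((A * A - B * B) * (A * A - B * B)) +
        (1 / 24 : ℝ) •
          (((3 : ℝ) • (A * A + B * B) + (2 : ℝ) • (A * B + B * A)) *
            ((3 : ℝ) • (A * A + B * B) + (2 : ℝ) • (A * B + B * A))) := by
  simp only [nchs, sum_words_succ, Finset.univ_unique, Finset.sum_singleton, wordProd,
    nchsCoeff, letterCount_eq_sum, Fin.prod_univ_two, Fin.sum_univ_succ, List.ofFn_succ]
  simp [Nat.factorial, pow_succ, mul_add, add_mul, mul_sub, sub_mul, smul_smul, smul_sub,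
    mul_assoc]
  module

theorem mulVec_mul_self_dotProduct {m : Type*} [Fintype m] {M : Matrix m m ℝ} (hM : M.IsSymm)
    (v : m → ℝ) : v ⬝ᵥ (M * M) *ᵥ v = M *ᵥ v ⬝ᵥ M *ᵥ v := by
  rw [← mulVec_mulVec, dotProduct_mulVec, ← mulVec_transpose, hM.eq]

/-- For real symmetric matrices `X₁, X₂`, the kernel of
`H₄(X₁, X₂) − (5/12)(X₁⁴ + X₂⁴)` equals `ker X₁ ∩ ker X₂`. -/
theorem stmt_8 (k : ℕ) (X₁ X₂ : Matrix (Fin k) (Fin k) ℝ)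
    (h₁ : X₁.IsSymm) (h₂ : X₂.IsSymm) :
    ∀ v : Fin k → ℝ,
      (nchs 4 ![X₁, X₂] - (5 / 12 : ℝ) • (X₁ ^ 4 + X₂ ^ 4)).mulVec v = 0 ↔
        X₁.mulVec v = 0 ∧ X₂.mulVec v = 0 := by
  intro v
  rw [nchs_four_sub_eq]
  set D := X₁ * X₁ - X₂ * X₂ with hD
  set E := (3 : ℝ) • (X₁ * X₁ + X₂ * X₂) + (2 : ℝ) • (X₁ * X₂ + X₂ * X₁) with hE
  have hDs : D.IsSymm := by
    simp [hD, IsSymm, transpose_mul, h₁.eq, h₂.eq]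
  have hEs : E.IsSymm := by
    simp [hE, IsSymm, transpose_mul, h₁.eq, h₂.eq, add_comm]
  constructor
  · intro h
    have hsq := congrArg (v ⬝ᵥ ·) h
    simp only [add_mulVec, smul_mulVec, dotProduct_add, dotProduct_smul,
      mulVec_mul_self_dotProduct hDs, mulVec_mul_self_dotProduct hEs, dotProduct_zero,
      smul_eq_mul] at hsq
    have hDn : 0 ≤ D *ᵥ v ⬝ᵥ D *ᵥ v := Finset.sum_nonneg fun _ _ => mul_self_nonneg _
    have hEn : 0 ≤ E *ᵥ v ⬝ᵥ E *ᵥ v := Finset.sum_nonneg fun _ _ => mul_self_nonneg _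
    have hD0 : D *ᵥ v = 0 := dotProduct_self_eq_zero.mp (by linarith)
    have hE0 : E *ᵥ v = 0 := dotProduct_self_eq_zero.mp (by linarith)
    have hS : (X₁ + X₂).IsSymm := h₁.add h₂
    have hsum : (X₁ + X₂) * (X₁ + X₂) + X₁ * X₁ = (1 / 2 : ℝ) • (E + D) := by
      simp only [hD, hE, add_mul, mul_add]
      module
    have hnorm : (X₁ + X₂) *ᵥ v ⬝ᵥ (X₁ + X₂) *ᵥ v + X₁ *ᵥ v ⬝ᵥ X₁ *ᵥ v = 0 := by
      rw [← mulVec_mul_self_dotProduct hS, ← mulVec_mul_self_dotProduct h₁, ← dotProduct_add,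
        ← add_mulVec, hsum, smul_mulVec, add_mulVec, hD0, hE0, add_zero, smul_zero,
        dotProduct_zero]
    have hSn : 0 ≤ (X₁ + X₂) *ᵥ v ⬝ᵥ (X₁ + X₂) *ᵥ v :=
      Finset.sum_nonneg fun _ _ => mul_self_nonneg _
    have hXn : 0 ≤ X₁ *ᵥ v ⬝ᵥ X₁ *ᵥ v := Finset.sum_nonneg fun _ _ => mul_self_nonneg _
    have hX0 : X₁ *ᵥ v = 0 := dotProduct_self_eq_zero.mp (by linarith)
    have hS0 : (X₁ + X₂) *ᵥ v = 0 := dotProduct_self_eq_zero.mp (by linarith)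
    rw [add_mulVec, hX0, zero_add] at hS0
    exact ⟨hX0, hS0⟩
  · rintro ⟨hX, hY⟩
    have hD0 : D *ᵥ v = 0 := by simp [hD, sub_mulVec, ← mulVec_mulVec, hX, hY]
    have hE0 : E *ᵥ v = 0 := by simp [hE, add_mulVec, smul_mulVec, ← mulVec_mulVec, hX, hY]
    simp [add_mulVec, smul_mulVec, ← mulVec_mulVec, hD0, hE0]
end

section
/- Let n ≥ 2 and d ≥ 1 be natural numbers. Then the maximum of the set {μ ∈ ℝ : G_{n,d} − μ·M_{n,d} is positive semidefinite} exists and equals C(n−1+2d, 2d) / (C(n−1+d, d) · (C(n−1+d, d) + Δ)), where Δ = 1 if d is odd and Δ = n−1 if d is even. -/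
open Matrix BigOperators

/-- The matrix `G_{n,d}`, indexed by words of degree `d` in `n` letters. -/
noncomputable def Gmat (n d : ℕ) : Matrix (Fin d → Fin n) (Fin d → Fin n) ℝ :=
  fun u v =>
    ((∏ j : Fin n, (letterCount u j + letterCount v j).factorial : ℕ) : ℝ) /
      ((2 * d).factorial : ℝ)

/-- The diagonal 0–1 matrix `M_{n,d}` whose diagonal entry at a word `w` is 1
iff `w` is a constant word. -/
noncomputable def Mmat (n d : ℕ) : Matrix (Fin d → Fin n) (Fin d → Fin n) ℝ :=
  fun u v => if u = v ∧ ∃ j : Fin n, u = fun _ => j then 1 else 0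

lemma letterCount_cons {n d : ℕ} (j : Fin n) (w : Fin d → Fin n) (i : Fin n) :
    letterCount (Fin.cons j w : Fin (d + 1) → Fin n) i =
      letterCount w i + if j = i then 1 else 0 := by
  simp only [letterCount, Finset.card_filter, Fin.sum_univ_succ, Fin.cons_zero, Fin.cons_succ,
    add_comm]

lemma sum_letterCount {n d : ℕ} (w : Fin d → Fin n) : ∑ j, letterCount w j = d := by
  simpa [letterCount] using
    (Finset.card_eq_sum_card_fiberwise (f := w) (s := Finset.univ) (t := Finset.univ)
      (by simp)).symm

lemma letterCount_le {n d : ℕ} (w : Fin d → Fin n) (j : Fin n) : letterCount w j ≤ d :=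
  (Finset.card_filter_le _ _).trans (by simp)

lemma letterCount_const {n : ℕ} (d : ℕ) (i j : Fin n) :
    letterCount (fun _ : Fin d => i) j = if i = j then d else 0 := by
  by_cases h : i = j <;> simp [letterCount, h]

lemma eq_const_of_letterCount_eq {n d : ℕ} {w : Fin d → Fin n} {i : Fin n}
    (h : letterCount w i = d) : w = fun _ => i := by
  have h' := Finset.card_filter_eq_iff.mp (h.trans (Finset.card_fin d).symm)
  exact funext fun x => h' x (Finset.mem_univ x)

lemma prod_factorial_add_ite {ι : Type*} [Fintype ι] [DecidableEq ι] (β : ι → ℕ) (j : ι) :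
    ∏ x, (β x + if j = x then 1 else 0).factorial = (β j + 1) * ∏ x, (β x).factorial := by
  rw [← Finset.mul_prod_erase _ _ (Finset.mem_univ j),
    ← Finset.mul_prod_erase Finset.univ (fun x => (β x).factorial) (Finset.mem_univ j),
    Finset.prod_congr rfl (g := fun x => (β x).factorial)]
  · simp [Nat.factorial_succ, mul_assoc]
  · intro x hx
    simp [(Finset.ne_of_mem_erase hx).symm]

/-- A Pólya urn identity: the sum over all words of a product of shifted factorials, weighted by a
function of the number of occurrences of a fixed letter `i`. -/
lemma sum_prod_factorial_mul {p : ℕ} (α : Fin (p + 2) → ℕ) (i : Fin (p + 2)) (d : ℕ)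
    (f : ℕ → ℝ) :
    ((∑ j ∈ Finset.univ.erase i, α j + p).factorial : ℝ) *
        ∑ w : Fin d → Fin (p + 2),
          ((∏ j, (α j + letterCount w j).factorial : ℕ) : ℝ) * f (letterCount w i) =
      ((∏ j ∈ Finset.univ.erase i, (α j).factorial : ℕ) : ℝ) *
        ∑ kl ∈ Finset.HasAntidiagonal.antidiagonal d, (d.choose kl.1 : ℝ) *
          (f kl.1 * (α i + kl.1).factorial *
            (∑ j ∈ Finset.univ.erase i, α j + kl.2 + p).factorial) := by
  induction d generalizing f with
  | zero =>
    simp [letterCount, ← Finset.mul_prod_erase Finset.univ _ (Finset.mem_univ i)]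
    ring
  | succ d ih =>
    set m := ∑ j ∈ Finset.univ.erase i, α j with hm
    let g : ℕ → ℝ := fun k =>
      (α i + k + 1 : ℝ) * f (k + 1) + (m + (d - k) + p + 1) * f k
    have key : ∀ w : Fin d → Fin (p + 2),
        ∑ j, ((∏ x, (α x + letterCount (Fin.cons j w : Fin (d + 1) → Fin (p + 2)) x).factorial
            : ℕ) : ℝ) * f (letterCount (Fin.cons j w : Fin (d + 1) → Fin (p + 2)) i) =
          ((∏ x, (α x + letterCount w x).factorial : ℕ) : ℝ) *
            g (letterCount w i) := by
      intro w
      have hrest : (∑ j ∈ Finset.univ.erase i, ((α j + letterCount w j : ℕ) + 1 : ℝ)) =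
          m + (d - letterCount w i) + p + 1 := by
        have h1 := sum_letterCount w
        rw [← Finset.add_sum_erase _ _ (Finset.mem_univ i)] at h1
        have h2 : (d : ℝ) = letterCount w i +
            ∑ j ∈ Finset.univ.erase i, (letterCount w j : ℝ) := by exact_mod_cast h1.symm
        simp only [Nat.cast_add, Finset.sum_add_distrib, Finset.sum_const, h2, hm]
        rw [Finset.card_erase_of_mem (Finset.mem_univ i)]
        simp
        ring
      simp only [g, letterCount_cons, ← add_assoc, prod_factorial_add_ite]
      rw [← Finset.add_sum_erase _ _ (Finset.mem_univ i), ← hrest]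
      simp only [if_true, Finset.sum_mul, mul_add, Finset.mul_sum]
      congr 1
      · push_cast; ring
      · refine Finset.sum_congr rfl fun j hj => ?_
        rw [if_neg (Finset.ne_of_mem_erase hj), add_zero]
        push_cast; ring
    rw [← (Fin.consEquiv fun _ : Fin (d + 1) => Fin (p + 2)).sum_comp, Fintype.sum_prod_type_right]
    change _ * ∑ w : Fin d → Fin (p + 2), ∑ j, ((∏ x, (α x +
      letterCount (Fin.cons j w : Fin (d + 1) → Fin (p + 2)) x).factorial : ℕ) : ℝ) *
        f (letterCount (Fin.cons j w : Fin (d + 1) → Fin (p + 2)) i) = _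
    rw [Finset.sum_congr rfl fun w _ => key w, ih g, Finset.sum_antidiagonal_choose_succ_mul
      (fun k l => f k * ((α i + k).factorial : ℝ) * ((m + l + p).factorial : ℝ)),
      ← Finset.sum_add_distrib]
    congr 1
    refine Finset.sum_congr rfl fun kl hkl => ?_
    have hkl : kl.1 + kl.2 = d := Finset.HasAntidiagonal.mem_antidiagonal.mp hkl
    have hc : d.choose kl.2 = d.choose kl.1 := by rw [← hkl, Nat.choose_symm_add]
    rw [hc, show m + (kl.2 + 1) + p = (m + kl.2 + p) + 1 by ring,
      show α i + (kl.1 + 1) = (α i + kl.1) + 1 by ring, Nat.factorial_succ, Nat.factorial_succ]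
    have : (d : ℝ) = kl.1 + kl.2 := by exact_mod_cast hkl.symm
    simp only [g, this]
    push_cast
    ring

lemma factorial_add_eq_sum {k l d : ℕ} (hl : l ≤ d) :
    (k + l).factorial = ∑ r : Fin (d + 1),
      (k.factorial * k.choose r) * (l.factorial * l.choose r) := by
  have h1 : (k + l).choose l = ∑ r ∈ Finset.range (d + 1), k.choose r * l.choose r := by
    rw [Nat.add_choose_eq, Finset.Nat.sum_antidiagonal_eq_sum_range_succ_mk]
    rw [← Finset.sum_subset (Finset.range_mono (Nat.succ_le_succ hl))]
    · refine Finset.sum_congr rfl fun r hr => ?_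
      rw [Nat.choose_symm (Finset.mem_range_succ_iff.mp hr)]
    · intro r _ hr
      rw [Finset.mem_range_succ_iff, not_le] at hr
      rw [Nat.choose_eq_zero_of_lt hr, mul_zero]
  rw [← Nat.add_choose_mul_factorial_mul_factorial, h1,
    ← Fin.sum_univ_eq_sum_range (fun r => k.choose r * l.choose r), mul_assoc, Finset.sum_mul]
  exact Finset.sum_congr rfl fun r _ => by ring

lemma posSemidef_Gmat (n d : ℕ) : (Gmat n d).PosSemidef := by
  let B : Matrix (Fin n → Fin (d + 1)) (Fin d → Fin n) ℝ := Matrix.of fun r u =>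
    ∏ j, (((letterCount u j).factorial * (letterCount u j).choose (r j) : ℕ) : ℝ)
  have h : Gmat n d = (((2 * d).factorial : ℝ)⁻¹) • (Bᴴ * B) := by
    ext u v
    rw [Matrix.smul_apply, Matrix.mul_apply, Gmat, div_eq_inv_mul, smul_eq_mul]
    congr 1
    rw [Finset.prod_congr rfl fun j _ => factorial_add_eq_sum (letterCount_le v j),
      Finset.prod_univ_sum]
    push_cast
    simp [B, Matrix.conjTranspose_apply, Finset.prod_mul_distrib]
  rw [h]
  exact (Matrix.posSemidef_conjTranspose_mul_self B).smul (by positivity)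

lemma sum_antidiagonal_neg_one_pow_div (d p : ℕ) :
    ∑ kl ∈ Finset.HasAntidiagonal.antidiagonal d,
        (d.choose kl.1 : ℝ) * ((-1) ^ kl.2 / (kl.2 + p + 1)) =
      d.factorial * p.factorial / (p + d + 1).factorial := by
  induction d generalizing p with
  | zero =>
    simp [Nat.factorial_succ]
    field_simp
  | succ d ih =>
    rw [Finset.sum_antidiagonal_choose_succ_mul
      (fun k l => (-1 : ℝ) ^ l / (l + p + 1))]
    have h1 : ∑ kl ∈ Finset.HasAntidiagonal.antidiagonal d, (d.choose kl.2 : ℝ) *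
        ((-1) ^ kl.2 / (kl.2 + p + 1)) = d.factorial * p.factorial / (p + d + 1).factorial := by
      rw [← ih]
      refine Finset.sum_congr rfl fun kl hkl => ?_
      rw [← Finset.HasAntidiagonal.mem_antidiagonal.mp hkl, Nat.choose_symm_add]
    have h2 : ∑ kl ∈ Finset.HasAntidiagonal.antidiagonal d, (d.choose kl.1 : ℝ) *
        ((-1) ^ (kl.2 + 1) / ((kl.2 + 1 : ℕ) + p + 1)) =
          - (d.factorial * (p + 1).factorial / (p + 1 + d + 1).factorial) := by
      rw [← ih, ← Finset.sum_neg_distrib]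
      refine Finset.sum_congr rfl fun kl _ => ?_
      push_cast
      ring
    rw [h1, h2, show p + 1 + d + 1 = (p + d + 1) + 1 by ring,
      show p + (d + 1) + 1 = (p + d + 1) + 1 by ring, Nat.factorial_succ (p + d + 1),
      Nat.factorial_succ p, Nat.factorial_succ d]
    push_cast
    field_simp
    ring

open Polynomial in
/-- Partial fractions for an alternating binomial sum of polynomial values. -/
lemma sum_antidiagonal_neg_one_pow_mul_eval_div (d p : ℕ) (Q : ℝ[X]) (hQ : Q.natDegree ≤ d) :
    ∑ kl ∈ Finset.HasAntidiagonal.antidiagonal d,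
        (d.choose kl.1 : ℝ) * ((-1) ^ kl.2 * Q.eval (kl.1 : ℝ) / (kl.2 + p + 1)) =
      Q.eval (d + p + 1 : ℝ) * (d.factorial * p.factorial / (p + d + 1).factorial) := by
  set c : ℝ := d + p + 1
  set R := Q /ₘ (X - C c)
  have hR : ∀ x, Q.eval x = Q.eval c + (x - c) * R.eval x := fun x => by
    conv_lhs => rw [← modByMonic_add_div Q (X - C c), modByMonic_X_sub_C_eq_C_eval]
    simp [R]
  have hzero : ∑ kl ∈ Finset.HasAntidiagonal.antidiagonal d,
      (d.choose kl.1 : ℝ) * ((-1) ^ kl.2 * R.eval (kl.1 : ℝ)) = 0 := by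
    rcases Nat.eq_zero_or_pos d with rfl | hd
    · have : R = 0 := by
        rw [Polynomial.divByMonic_eq_zero_iff (monic_X_sub_C c), degree_X_sub_C]
        exact degree_le_natDegree.trans_lt (by exact_mod_cast Nat.lt_succ_of_le hQ)
      simp [this]
    · have hdeg : R.natDegree < d := by
        rw [natDegree_divByMonic _ (monic_X_sub_C c), natDegree_X_sub_C]
        omega
      have h := congrFun (Polynomial.fwdDiff_iter_eq_zero_of_degree_lt hdeg) 0
      rw [fwdDiff_iter_eq_sum_shift] at h
      rw [Finset.Nat.sum_antidiagonal_eq_sum_range_succ_mk]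
      refine Eq.trans (Finset.sum_congr rfl fun k _ => ?_) h
      simp
      ring
  rw [← sum_antidiagonal_neg_one_pow_div, Finset.mul_sum, ← sub_eq_zero,
    ← Finset.sum_sub_distrib, ← neg_eq_zero, ← hzero, ← Finset.sum_neg_distrib]
  refine Finset.sum_congr rfl fun kl hkl => ?_
  have hd : (d : ℝ) = kl.1 + kl.2 := by
    exact_mod_cast (Finset.HasAntidiagonal.mem_antidiagonal.mp hkl).symm
  have hpos : (kl.2 + p + 1 : ℝ) ≠ 0 := by positivity
  rw [hR kl.1, show (kl.1 : ℝ) - c = -(kl.2 + p + 1) by simp only [c, hd]; ring]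
  field_simp
  ring

lemma eval_ascPochhammer_eq_div (m x : ℕ) :
    (ascPochhammer ℝ m).eval (x + 1 : ℝ) = ((x + m).factorial : ℝ) / x.factorial := by
  rw [eq_div_iff (by positivity)]
  have h := ascPochhammer_nat_eq_ascFactorial (x + 1) m
  have h2 := Nat.factorial_mul_ascFactorial x m
  rw [← h2, ← h]
  rw [Nat.cast_mul, ascPochhammer_eval_cast]
  push_cast
  ring

open Polynomial in
lemma sum_antidiagonal_factorial_ratio (p a m : ℕ) :
    ∑ kl ∈ Finset.HasAntidiagonal.antidiagonal (a + m), ((a + m).choose kl.1 : ℝ) *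
        ((-1) ^ kl.2 / (kl.1.factorial * (kl.2 + p + 1).factorial) * (a + kl.1).factorial *
          (m + kl.2 + p).factorial) =
      if m = 0 then ((2 * a + p + 1).factorial : ℝ) * a.factorial * p.factorial /
        ((a + p + 1).factorial : ℝ) ^ 2 else 0 := by
  let Q : ℝ[X] := (ascPochhammer ℝ a).comp (X + C 1) *
    (ascPochhammer ℝ m).comp (C ((a + m : ℕ) + p + 1 : ℝ) - X)
  have hQ : Q.natDegree ≤ a + m := by
    refine natDegree_mul_le.trans (add_le_add ?_ ?_)
    · exact natDegree_comp_le.trans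
        (by rw [ascPochhammer_natDegree, natDegree_X_add_C, mul_one])
    · refine natDegree_comp_le.trans ?_
      rw [ascPochhammer_natDegree]
      have : (C ((a + m : ℕ) + p + 1 : ℝ) - X).natDegree ≤ 1 :=
        (natDegree_sub_le _ _).trans (by rw [natDegree_C, natDegree_X]; simp)
      simpa using Nat.mul_le_mul_left m this
  refine (Finset.sum_congr rfl fun kl hkl => ?_).trans
    ((sum_antidiagonal_neg_one_pow_mul_eval_div (a + m) p Q hQ).trans ?_)
  · have hd : ((a + m : ℕ) : ℝ) = kl.1 + kl.2 := by
      exact_mod_cast (Finset.HasAntidiagonal.mem_antidiagonal.mp hkl).symm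
    have h2 : ((a + m : ℕ) + p + 1 - kl.1 : ℝ) = (kl.2 + p : ℕ) + 1 := by
      rw [hd]; push_cast; ring
    simp only [Q, eval_mul, eval_comp, eval_add, eval_sub, eval_X, eval_C, h2,
      eval_ascPochhammer_eq_div, Nat.factorial_succ]
    rw [add_comm a kl.1, show m + kl.2 + p = kl.2 + p + m by ring]
    push_cast
    field_simp
  · split_ifs with h
    · subst h
      have h3 : ((a + 0 : ℕ) + p + 1 + 1 : ℝ) = (a + p + 1 : ℕ) + 1 := by push_cast; ring
      simp only [Q, eval_mul, eval_comp, eval_add, eval_sub, eval_X, eval_C, h3,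
        eval_ascPochhammer_eq_div, ascPochhammer_zero, eval_one]
      rw [show a + p + 1 + a = 2 * a + p + 1 by ring, show p + (a + 0) + 1 = a + p + 1 by ring,
        add_zero]
      field_simp
    · simp [Q, eval_comp, ascPochhammer_ne_zero_eval_zero ℝ h]

lemma Mmat_mulVec_apply {n d : ℕ} (x : (Fin d → Fin n) → ℝ) (w : Fin d → Fin n) :
    (Mmat n d *ᵥ x) w = if ∃ j : Fin n, w = fun _ => j then x w else 0 := by
  simp [Mmat, Matrix.mulVec, dotProduct, ite_and]

lemma Mmat_mulVec {n d : ℕ} (hd : 1 ≤ d) (x : (Fin d → Fin n) → ℝ) :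
    Mmat n d *ᵥ x = ∑ j, x (fun _ => j) • Pi.single (fun _ => j) 1 := by
  have : Nonempty (Fin d) := ⟨⟨0, hd⟩⟩
  ext w
  rw [Mmat_mulVec_apply, Finset.sum_apply]
  split_ifs with h
  · obtain ⟨j, rfl⟩ := h
    rw [Finset.sum_eq_single j]
    · simp
    · intro k _ hk
      have : (fun _ : Fin d => j) ≠ fun _ => k := fun h => hk (Function.const_injective h).symm
      simp [this]
    · simp
  · refine (Finset.sum_eq_zero fun j _ => ?_).symm
    have : w ≠ fun _ => j := fun e => h ⟨j, e⟩
    simp [this]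

lemma isHermitian_Mmat (n d : ℕ) : (Mmat n d).IsHermitian := by
  ext u v
  by_cases h : u = v
  · subst h; rfl
  · simp [Mmat, h, Ne.symm h]

/-- If the Gram matrix sends the vectors `Z j` to multiples of the indicators of the constant words,
the largest admissible `μ` is controlled by the top eigenvalue of `K i j = Z j (const i)`. -/
lemma isGreatest_posSemidef_of_mulVec {n d : ℕ} (hd : 1 ≤ d)
    (Z : Fin n → (Fin d → Fin n) → ℝ) {γ l : ℝ} (hγ : 0 < γ) (hl : 0 < l)
    (hZ : ∀ i, Gmat n d *ᵥ Z i = γ • Pi.single (fun _ => i) 1)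
    (hle : ∀ y : Fin n → ℝ, ∑ i, y i * ∑ j, y j * Z j (fun _ => i) ≤ l * ∑ i, y i ^ 2)
    (y₀ : Fin n → ℝ) (hy₀ : 0 < ∑ i, y₀ i ^ 2)
    (heig : ∀ i, ∑ j, y₀ j * Z j (fun _ => i) = l * y₀ i) :
    IsGreatest {μ : ℝ | (Gmat n d - μ • Mmat n d).PosSemidef} (γ / l) := by
  have hG := posSemidef_Gmat n d
  have hcomb (y : Fin n → ℝ) : Gmat n d *ᵥ (∑ j, y j • Z j) =
      γ • ∑ j, y j • Pi.single (fun _ : Fin d => j) (1 : ℝ) := by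
    simp only [Matrix.mulVec_sum, Matrix.mulVec_smul, hZ, Finset.smul_sum]
    exact Finset.sum_congr rfl fun j _ => smul_comm _ _ _
  have hdot (x : (Fin d → Fin n) → ℝ) (y : Fin n → ℝ) :
      x ⬝ᵥ (∑ j, y j • Pi.single (fun _ : Fin d => j) (1 : ℝ)) = ∑ j, y j * x (fun _ => j) := by
    simp [dotProduct_sum, dotProduct_smul]
  have hval (y : Fin n → ℝ) (i : Fin n) :
      (∑ j, y j • Z j) (fun _ => i) = ∑ j, y j * Z j (fun _ => i) := by
    simp [Finset.sum_apply]
  have hform (μ : ℝ) (x : (Fin d → Fin n) → ℝ) : star x ⬝ᵥ ((Gmat n d - μ • Mmat n d) *ᵥ x) =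
      x ⬝ᵥ (Gmat n d *ᵥ x) - μ * ∑ j, x (fun _ => j) ^ 2 := by
    rw [Matrix.sub_mulVec, dotProduct_sub, Matrix.smul_mulVec, dotProduct_smul, Mmat_mulVec hd,
      star_trivial, hdot]
    simp [sq]
  constructor
  · refine .of_dotProduct_mulVec_nonneg
      (hG.isHermitian.sub ((isHermitian_Mmat n d).smul (IsSelfAdjoint.all _))) fun x => ?_
    rw [hform]
    set y : Fin n → ℝ := fun j => x fun _ => j
    set q := ∑ j, y j • Z j with hq
    have hsymm : q ⬝ᵥ (Gmat n d *ᵥ x) = x ⬝ᵥ (Gmat n d *ᵥ q) := by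
      have hT : (Gmat n d)ᵀ = Gmat n d := by simpa using hG.isHermitian.eq
      rw [Matrix.dotProduct_mulVec, ← Matrix.mulVec_transpose, hT, dotProduct_comm]
    have h1 : x ⬝ᵥ (Gmat n d *ᵥ q) = γ * ∑ j, y j ^ 2 := by
      rw [hq, hcomb, dotProduct_smul, hdot]
      simp [sq, y]
    have h2 : q ⬝ᵥ (Gmat n d *ᵥ q) ≤ γ * (l * ∑ j, y j ^ 2) := by
      nth_rewrite 2 [hq]
      rw [hcomb, dotProduct_smul, hdot, smul_eq_mul]
      simp only [q, hval]
      exact mul_le_mul_of_nonneg_left (hle y) hγ.le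
    have h3 := hG.dotProduct_mulVec_nonneg (x - l⁻¹ • q)
    simp only [star_trivial, Matrix.mulVec_sub, Matrix.mulVec_smul, dotProduct_sub, sub_dotProduct,
      smul_dotProduct, dotProduct_smul, smul_eq_mul, hsymm, h1] at h3
    have h4 : l⁻¹ * (l⁻¹ * (q ⬝ᵥ (Gmat n d *ᵥ q))) ≤ l⁻¹ * (l⁻¹ * (γ * (l * ∑ j, y j ^ 2))) := by
      gcongr
    have h5 : l⁻¹ * (l⁻¹ * (γ * (l * ∑ j, y j ^ 2))) = γ / l * ∑ j, y j ^ 2 := by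
      field_simp
    have h6 : l⁻¹ * (γ * ∑ j, y j ^ 2) = γ / l * ∑ j, y j ^ 2 := by
      field_simp
    change 0 ≤ _ - γ / l * ∑ j, y j ^ 2
    linarith
  · intro μ hμ
    have h := hμ.dotProduct_mulVec_nonneg (∑ j, y₀ j • Z j)
    rw [hform, hcomb, dotProduct_smul, hdot] at h
    simp only [hval, heig, smul_eq_mul, mul_pow, ← Finset.mul_sum] at h
    have h1 : ∑ j, y₀ j * (l * y₀ j) = l * ∑ j, y₀ j ^ 2 := by
      rw [Finset.mul_sum]
      exact Finset.sum_congr rfl fun j _ => by ring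
    rw [h1] at h
    have h2 : 0 ≤ (l * ∑ j, y₀ j ^ 2) * (γ - μ * l) := by linarith
    rw [le_div_iff₀ hl]
    exact sub_nonneg.mp (nonneg_of_mul_nonneg_right h2 (by positivity))

/-- The coefficients, up to scaling, of the polynomial representing evaluation at the `i`-th vertex
of the simplex. -/
noncomputable def vertexKernel (p d : ℕ) (i : Fin (p + 2)) (w : Fin d → Fin (p + 2)) : ℝ :=
  (-1) ^ (d - letterCount w i) /
    ((letterCount w i).factorial * (d - letterCount w i + p + 1).factorial)

lemma Gmat_mulVec_vertexKernel (p d : ℕ) (i : Fin (p + 2)) :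
    Gmat (p + 2) d *ᵥ vertexKernel p d i =
      (((2 * d + p + 1).factorial : ℝ) * d.factorial /
        ((2 * d).factorial * ((d + p + 1).factorial : ℝ) ^ 2)) • Pi.single (fun _ => i) 1 := by
  ext u
  set m := ∑ j ∈ Finset.univ.erase i, letterCount u j with hm
  have hd : letterCount u i + m = d :=
    (Finset.add_sum_erase _ _ (Finset.mem_univ i)).trans (sum_letterCount u)
  have hurn := sum_prod_factorial_mul (letterCount u) i d
    (fun k => (-1) ^ (d - k) / (k.factorial * (d - k + p + 1).factorial))
  have hratio := sum_antidiagonal_factorial_ratio p (letterCount u i) m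
  rw [hd] at hratio
  have hsum : ∑ kl ∈ Finset.HasAntidiagonal.antidiagonal d, (d.choose kl.1 : ℝ) *
      ((-1) ^ (d - kl.1) / (kl.1.factorial * (d - kl.1 + p + 1).factorial) *
        (letterCount u i + kl.1).factorial * (m + kl.2 + p).factorial) = _ :=
    (Finset.sum_congr rfl fun kl hkl => by
      rw [show d - kl.1 = kl.2 by
        have := Finset.HasAntidiagonal.mem_antidiagonal.mp hkl
        omega]).trans hratio
  rw [hsum, ← hm] at hurn
  have hG : (Gmat (p + 2) d *ᵥ vertexKernel p d i) u = (∑ w : Fin d → Fin (p + 2),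
      ((∏ j, (letterCount u j + letterCount w j).factorial : ℕ) : ℝ) *
        ((-1) ^ (d - letterCount w i) / ((letterCount w i).factorial *
          (d - letterCount w i + p + 1).factorial))) / (2 * d).factorial := by
    rw [Finset.sum_div]
    exact Finset.sum_congr rfl fun w _ => div_mul_eq_mul_div _ _ _
  rw [hG, Pi.smul_apply, smul_eq_mul]
  by_cases h0 : m = 0
  · have hi : letterCount u i = d := by omega
    have hprod : ∏ j ∈ Finset.univ.erase i, (letterCount u j).factorial = 1 :=
      Finset.prod_eq_one fun j hj => by
        rw [Finset.sum_eq_zero_iff.mp (hm.symm.trans h0) j hj, Nat.factorial_zero]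
    rw [if_pos h0, hi, hprod, h0, zero_add] at hurn
    rw [eq_const_of_letterCount_eq hi, Pi.single_eq_same, ← eq_const_of_letterCount_eq hi]
    have hp : (p.factorial : ℝ) ≠ 0 := by positivity
    rw [eq_div_of_mul_eq hp ((mul_comm _ _).trans hurn)]
    push_cast
    field_simp
  · have hu : u ≠ fun _ => i := by
      rintro rfl
      rw [letterCount_const, if_pos rfl] at hd
      omega
    rw [if_neg h0, mul_zero] at hurn
    rw [(mul_eq_zero.mp hurn).resolve_left (by positivity)]
    simp [hu]

lemma vertexKernel_const (p : ℕ) {d : ℕ} (i j : Fin (p + 2)) :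
    vertexKernel p d j (fun _ => i) = (-1) ^ d / (d + p + 1).factorial +
      if i = j then (1 / (d.factorial * (p + 1).factorial) - (-1) ^ d / (d + p + 1).factorial : ℝ)
      else 0 := by
  by_cases h : i = j <;> simp [vertexKernel, letterCount_const, h]

lemma sum_mul_vertexKernel_const (p d : ℕ) (y : Fin (p + 2) → ℝ) (i : Fin (p + 2)) :
    ∑ j, y j * vertexKernel p d j (fun _ => i) = (-1) ^ d / (d + p + 1).factorial * ∑ j, y j +
      (1 / (d.factorial * (p + 1).factorial) - (-1) ^ d / (d + p + 1).factorial) * y i := by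
  simp only [vertexKernel_const, mul_add, Finset.sum_add_distrib, ← Finset.sum_mul, mul_ite,
    mul_zero, Finset.sum_ite_eq, Finset.mem_univ, if_true]
  ring

/-- The maximum of `{μ : G_{n,d} - μ M_{n,d} ⪰ 0}` exists and equals the explicit
formula for `μ_{n,d}`. -/
theorem stmt_14 (n d : ℕ) (hn : 2 ≤ n) (hd : 1 ≤ d) :
    IsGreatest {μ : ℝ | (Gmat n d - μ • Mmat n d).PosSemidef}
      (((n - 1 + 2 * d).choose (2 * d) : ℝ) /
        (((n - 1 + d).choose d : ℝ) *
          (((n - 1 + d).choose d : ℝ) + if Odd d then 1 else ((n - 1 : ℕ) : ℝ)))) := by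
  obtain ⟨p, rfl⟩ := Nat.exists_eq_add_of_le' hn
  rw [show p + 2 - 1 = p + 1 from rfl]
  set A : ℝ := 1 / (d.factorial * (p + 1).factorial) with hA
  set B : ℝ := 1 / (d + p + 1).factorial with hB
  have hA0 : 0 < A := by positivity
  have hB0 : 0 < B := by positivity
  set δ : ℝ := if Odd d then 1 else ((p + 1 : ℕ) : ℝ) with hδ
  have hδ0 : 0 < δ := by
    rw [hδ]
    split_ifs <;> positivity
  have hK (y : Fin (p + 2) → ℝ) (i : Fin (p + 2)) :
      ∑ j, y j * vertexKernel p d j (fun _ => i) =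
        (-1) ^ d * B * ∑ j, y j + (A - (-1) ^ d * B) * y i := by
    rw [sum_mul_vertexKernel_const, hA, hB, mul_one_div]
  have hquad (y : Fin (p + 2) → ℝ) :
      ∑ i, y i * ∑ j, y j * vertexKernel p d j (fun _ => i) =
        (-1) ^ d * B * (∑ j, y j) ^ 2 + (A - (-1) ^ d * B) * ∑ i, y i ^ 2 := by
    simp only [hK, mul_add, Finset.sum_add_distrib, Finset.mul_sum, sq, Finset.sum_mul]
    congr 1
    · rw [Finset.sum_comm]
      exact Finset.sum_congr rfl fun _ _ => Finset.sum_congr rfl fun _ _ => by ring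
    · exact Finset.sum_congr rfl fun _ _ => by ring
  have hle (y : Fin (p + 2) → ℝ) :
      ∑ i, y i * ∑ j, y j * vertexKernel p d j (fun _ => i) ≤
        (A + δ * B) * ∑ i, y i ^ 2 := by
    rw [hquad]
    by_cases ho : Odd d
    · rw [hδ, if_pos ho, ho.neg_one_pow]
      nlinarith [mul_nonneg hB0.le (sq_nonneg (∑ j, y j))]
    · have hcs := sq_sum_le_card_mul_sum_sq (s := Finset.univ) (f := y)
      rw [Finset.card_fin] at hcs
      rw [hδ, if_neg ho, (Nat.not_odd_iff_even.mp ho).neg_one_pow]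
      push_cast at hcs ⊢
      nlinarith [mul_le_mul_of_nonneg_left hcs hB0.le]
  obtain ⟨y₀, hy₀, heig⟩ : ∃ y : Fin (p + 2) → ℝ, 0 < ∑ i, y i ^ 2 ∧
      ∀ i, ∑ j, y j * vertexKernel p d j (fun _ => i) = (A + δ * B) * y i := by
    by_cases ho : Odd d
    · refine ⟨Pi.single 0 1 - Pi.single 1 1, ?_, fun i => ?_⟩
      · refine Finset.sum_pos' (fun i _ => sq_nonneg _) ⟨0, Finset.mem_univ _, ?_⟩
        simp
      · rw [hK, hδ, if_pos ho, ho.neg_one_pow]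
        simp
    · refine ⟨fun _ => 1, by simp; positivity, fun i => ?_⟩
      rw [hK, hδ, if_neg ho, (Nat.not_odd_iff_even.mp ho).neg_one_pow]
      simp
      ring
  convert isGreatest_posSemidef_of_mulVec hd (vertexKernel p d) (by positivity) (by positivity)
    (Gmat_mulVec_vertexKernel p d) hle y₀ hy₀ heig using 1
  rw [add_comm (p + 1) (2 * d), add_comm (p + 1) d, Nat.cast_add_choose, Nat.cast_add_choose, hA,
    hB, ← add_assoc, ← add_assoc]
  field_simp
end

section
/- Let n ≥ 2 and d ≥ 3 be natural numbers. For every real β > 0 there exist k ∈ ℕ and real symmetric k×k matrices X_1, …, X_n such that H_{2d}(X_1, …, X_n) − β · (X_1² + ⋯ + X_n²)^d is not positive semidefinite. (There is no positive constant β for which the NCHS polynomial H_{2d} dominates β(x_1² + ⋯ + x_n²)^d on all tuples of symmetric matrices.) -/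
open Matrix BigOperators

theorem sum_pow_eq_sum_wordProd {R : Type*} [Ring R] {n : ℕ} (Y : Fin n → R) (D : ℕ) :
    (∑ j, Y j) ^ D = ∑ w : Fin D → Fin n, wordProd Y w := by
  induction D with
  | zero => simp [wordProd]
  | succ D ih =>
    rw [pow_succ', ih, Finset.sum_mul_sum, ← Finset.sum_product',
      Finset.univ_product_univ]
    refine Fintype.sum_equiv (Fin.consEquiv fun _ => Fin n) _ _ fun p => ?_
    simp [wordProd, Fin.consEquiv, List.ofFn_succ]

/-- The matrix `A` multiplied by the variable `j`. -/
noncomputable def variableSMul {n k : ℕ} (j : Fin n) (A : Matrix (Fin k) (Fin k) ℝ) :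
    Matrix (Fin k) (Fin k) (MvPolynomial (Fin n) ℝ) :=
  (MvPolynomial.X j : MvPolynomial (Fin n) ℝ) •
    A.map (MvPolynomial.C : ℝ →+* MvPolynomial (Fin n) ℝ)

theorem wordProd_variableSMul {n k D : ℕ} (X : Fin n → Matrix (Fin k) (Fin k) ℝ)
    (w : Fin D → Fin n) :
    wordProd (fun j => variableSMul j (X j)) w =
      MvPolynomial.monomial (∑ i, Finsupp.single (w i) 1) (1 : ℝ) •
        (wordProd X w).map (MvPolynomial.C : ℝ →+* MvPolynomial (Fin n) ℝ) := by
  induction D with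
  | zero => simp [wordProd, Matrix.map_one _ (map_zero MvPolynomial.C) (map_one MvPolynomial.C)]
  | succ D ih =>
    have h := ih (fun i => w i.succ)
    simp only [wordProd, List.ofFn_succ, List.prod_cons] at h ⊢
    rw [h, variableSMul, Fin.sum_univ_succ, Matrix.map_mul, MvPolynomial.X, smul_mul_smul_comm,
      MvPolynomial.monomial_mul, one_mul]

/-- The linear functional on polynomials replacing each power `x ^ k` of a variable by `k!`. -/
noncomputable def factorialFunctional (n : ℕ) : MvPolynomial (Fin n) ℝ →ₗ[ℝ] ℝ :=
  (MvPolynomial.basisMonomials (Fin n) ℝ).constr ℝ fun m => ((∏ j, (m j).factorial : ℕ) : ℝ)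

theorem factorialFunctional_monomial {n : ℕ} (m : Fin n →₀ ℕ) :
    factorialFunctional n (MvPolynomial.monomial m 1) = ((∏ j, (m j).factorial : ℕ) : ℝ) := by
  simpa [factorialFunctional] using
    (MvPolynomial.basisMonomials (Fin n) ℝ).constr_basis ℝ
      (fun m => ((∏ j, (m j).factorial : ℕ) : ℝ)) m

theorem sum_single_apply_eq_letterCount {n D : ℕ} (w : Fin D → Fin n) (j : Fin n) :
    (∑ i, Finsupp.single (w i) 1 : Fin n →₀ ℕ) j = letterCount w j := by
  simp [letterCount, Finsupp.finsetSum_apply, Finsupp.single_apply]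

/-- The NCHS polynomial is obtained by applying `factorialFunctional` to the entries of a power of
the generic linear combination of the matrices. -/
theorem nchs_apply {n k : ℕ} (D : ℕ) (X : Fin n → Matrix (Fin k) (Fin k) ℝ) (a b : Fin k) :
    nchs D X a b = factorialFunctional n
      (((∑ j, variableSMul j (X j)) ^ D) a b) / (D.factorial : ℝ) := by
  rw [sum_pow_eq_sum_wordProd, nchs, Matrix.sum_apply, Matrix.sum_apply, map_sum,
    Finset.sum_div]
  refine Finset.sum_congr rfl fun w _ => ?_
  rw [wordProd_variableSMul, Matrix.smul_apply, Matrix.smul_apply, Matrix.map_apply, smul_eq_mul,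
    smul_eq_mul, mul_comm (MvPolynomial.monomial _ _), ← MvPolynomial.smul_eq_C_mul, map_smul,
    factorialFunctional_monomial, smul_eq_mul, nchsCoeff]
  simp only [sum_single_apply_eq_letterCount]
  ring

/-- The linear pencil `x A + y B` of the two symmetric matrices of the counterexample. -/
def pencil {R : Type*} [CommRing R] (t x y : R) : Matrix (Fin 4) (Fin 4) R :=
  !![x, x, y, 0; x, 0, 0, t * y; y, 0, 0, -(t * x); 0, t * y, -(t * x), 0]

theorem pencil_pow_row_zero {R : Type*} [CommRing R] (x y : R) (D : ℕ) :
    ∃ p r : R, ∀ t : R, (pencil t x y ^ D) 0 0 = p ∧ (pencil t x y ^ D) 0 1 = r * x ∧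
      (pencil t x y ^ D) 0 2 = r * y ∧ (pencil t x y ^ D) 0 3 = 0 := by
  induction D with
  | zero => exact ⟨1, 0, fun t => by simp⟩
  | succ D ih =>
    obtain ⟨p, r, h⟩ := ih
    refine ⟨p * x + r * x * x + r * y * y, p, fun t => ?_⟩
    obtain ⟨h0, h1, h2, h3⟩ := h t
    simp only [pow_succ, Matrix.mul_apply, Fin.sum_univ_four, h0, h1, h2, h3]
    simp [pencil]
    ring

theorem pencil_isSymm {R : Type*} [CommRing R] (t x y : R) : (pencil t x y).IsSymm := by
  ext i j
  fin_cases i <;> fin_cases j <;> simp [pencil]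

theorem pencil_sq_add_sq (t : ℝ) :
    pencil t 1 0 ^ 2 + pencil t 0 1 ^ 2 =
      !![3, 1, 0, 0; 1, 1 + t ^ 2, 0, 0; 0, 0, 1 + t ^ 2, 0; 0, 0, 0, 2 * t ^ 2] := by
  ext i j
  fin_cases i <;> fin_cases j <;> simp [pencil, pow_two] <;>
    ring

theorem le_pencil_sq_add_sq_pow (t : ℝ) (m : ℕ) :
    1 + t ^ 2 ≤ ((pencil t 1 0 ^ 2 + pencil t 0 1 ^ 2) ^ (m + 3)) 0 0 ∧
      0 ≤ ((pencil t 1 0 ^ 2 + pencil t 0 1 ^ 2) ^ (m + 3)) 0 1 := by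
  rw [pencil_sq_add_sq]
  induction m with
  | zero =>
    constructor <;> simp [pow_succ, Matrix.mul_apply, Fin.sum_univ_four] <;>
      nlinarith [sq_nonneg t, sq_nonneg (t * t)]
  | succ m ih =>
    obtain ⟨h0, h1⟩ := ih
    rw [show m + 1 + 3 = (m + 3) + 1 by ring, pow_succ _ (m + 3), Matrix.mul_apply,
      Matrix.mul_apply]
    generalize (_ ^ (m + 3) : Matrix (Fin 4) (Fin 4) ℝ) = S at *
    simp only [Fin.sum_univ_four]
    constructor <;> simp <;> nlinarith [sq_nonneg t, mul_nonneg h1 (sq_nonneg t)]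

/-- The tuple whose first two matrices span the pencil and whose other matrices vanish. -/
def pencilTuple (m : ℕ) (t : ℝ) : Fin (m + 2) → Matrix (Fin 4) (Fin 4) ℝ :=
  Fin.cons (pencil t 1 0) (Fin.cons (pencil t 0 1) 0)

theorem nchs_pencilTuple_apply_zero (m D : ℕ) (t : ℝ) :
    nchs D (pencilTuple m t) 0 0 = nchs D (pencilTuple m 0) 0 0 := by
  have h : ∀ s : ℝ, ∑ j, variableSMul j (pencilTuple m s j) =
      pencil (MvPolynomial.C s) (MvPolynomial.X 0) (MvPolynomial.X 1) := by
    intro s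
    ext1 i j
    simp only [Fin.sum_univ_succ, pencilTuple, variableSMul, Matrix.sum_apply,
      Matrix.smul_apply, Matrix.map_apply, Fin.cons_zero, Fin.cons_succ, smul_eq_mul]
    fin_cases i <;> fin_cases j <;> simp [pencil, mul_comm]
  obtain ⟨p, r, hp⟩ := pencil_pow_row_zero (MvPolynomial.X 0 : MvPolynomial (Fin (m + 2)) ℝ)
    (MvPolynomial.X 1) D
  rw [nchs_apply, nchs_apply, h, h, (hp _).1, (hp _).1]

/-- For `n ≥ 2`, `d ≥ 3`, no `β > 0` satisfies
`H_{2d}(X₁,…,Xₙ) ⪰ β (X₁² + ⋯ + Xₙ²)^d` on all tuples of real symmetric matrices. -/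
theorem stmt_17 (n d : ℕ) (hn : 2 ≤ n) (hd : 3 ≤ d) (β : ℝ) (hβ : 0 < β) :
    ∃ (k : ℕ) (X : Fin n → Matrix (Fin k) (Fin k) ℝ),
      (∀ j, (X j).IsSymm) ∧
      ¬ (nchs (2 * d) X - β • (∑ j : Fin n, X j ^ 2) ^ d).PosSemidef := by
  obtain ⟨m, rfl⟩ := Nat.exists_eq_add_of_le' hn
  obtain ⟨e, rfl⟩ := Nat.exists_eq_add_of_le' hd
  set c := nchs (2 * (e + 3)) (pencilTuple m 0) 0 0 with hc
  set t : ℝ := 1 + |c| / β with ht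
  refine ⟨4, pencilTuple m t, ?_, fun hpsd => ?_⟩
  · refine Fin.cases (pencil_isSymm _ _ _) (Fin.cases (pencil_isSymm _ _ _) fun j => ?_)
    simp [pencilTuple]
  have hsum : ∑ j, pencilTuple m t j ^ 2 = pencil t 1 0 ^ 2 + pencil t 0 1 ^ 2 := by
    simp [Fin.sum_univ_succ, pencilTuple]
  have hdiag := hpsd.diag_nonneg (i := 0)
  rw [hsum, Matrix.sub_apply, Matrix.smul_apply, smul_eq_mul, nchs_pencilTuple_apply_zero,
    ← hc] at hdiag
  have hle := mul_le_mul_of_nonneg_left (le_pencil_sq_add_sq_pow t e).1 hβ.le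
  have hβt : β * t = β + |c| := by rw [ht]; field_simp
  have ht1 : 1 ≤ t := by rw [ht]; linarith [div_nonneg (abs_nonneg c) hβ.le]
  nlinarith [le_abs_self c, mul_nonneg hβ.le (mul_nonneg (sub_nonneg.2 ht1) (zero_le_one.trans ht1))]
end

section
/- For all real numbers x_1, x_2, one has h_4(x_1, x_2) = x_1^4 + x_1³x_2 + x_1²x_2² + x_1x_2³ + x_2^4 ≥ (1/2)(x_1^4 + x_2^4), and there exists (x_1, x_2) ≠ (0, 0) for which equality holds (for instance (1, −1)); hence 1/2 is the largest constant c with h_4(x_1, x_2) ≥ c(x_1^4 + x_2^4) for all real x_1, x_2. -/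
theorem half_mul_add_pow_four_le_hsymm_four (x y : ℝ) :
    x ^ 4 + x ^ 3 * y + x ^ 2 * y ^ 2 + x * y ^ 3 + y ^ 4 ≥ (1 / 2) * (x ^ 4 + y ^ 4) := by
  have h : 0 ≤ (x + y) ^ 2 * (x ^ 2 + y ^ 2) := by positivity
  linarith

/-- `h₄(x₁,x₂) ≥ (1/2)(x₁⁴ + x₂⁴)` with equality at the nonzero point `(1,-1)`;
hence `1/2` is the largest such constant. -/
theorem stmt_18 :
    (∀ x₁ x₂ : ℝ,
      x₁ ^ 4 + x₁ ^ 3 * x₂ + x₁ ^ 2 * x₂ ^ 2 + x₁ * x₂ ^ 3 + x₂ ^ 4 ≥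
        (1 / 2) * (x₁ ^ 4 + x₂ ^ 4)) ∧
    (∃ x₁ x₂ : ℝ, (x₁, x₂) ≠ (0, 0) ∧
      x₁ ^ 4 + x₁ ^ 3 * x₂ + x₁ ^ 2 * x₂ ^ 2 + x₁ * x₂ ^ 3 + x₂ ^ 4 =
        (1 / 2) * (x₁ ^ 4 + x₂ ^ 4)) ∧
    IsGreatest {c : ℝ | ∀ x₁ x₂ : ℝ,
        x₁ ^ 4 + x₁ ^ 3 * x₂ + x₁ ^ 2 * x₂ ^ 2 + x₁ * x₂ ^ 3 + x₂ ^ 4 ≥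
          c * (x₁ ^ 4 + x₂ ^ 4)} (1 / 2) := by
  refine ⟨half_mul_add_pow_four_le_hsymm_four, ⟨1, -1, by simp, by norm_num⟩,
    half_mul_add_pow_four_le_hsymm_four, fun c hc => ?_⟩
  have h := hc 1 (-1)
  norm_num at h
  linarith
end

section
/- For every k ∈ ℕ and all complex k×k matrices X_1, X_2, one has H_4(X_1, X_2) − (5/12)(X_1^4 + X_2^4) = (1/24)·S_1² + (5/24)·S_2², where S_1 = X_1² + X_2² + 2(X_1 + X_2)² and S_2 = X_1² − X_2². -/
open Matrix

/-- The SOHS identity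
`H₄(X₁,X₂) − (5/12)(X₁⁴ + X₂⁴) = (1/24) S₁² + (5/24) S₂²` with
`S₁ = X₁² + X₂² + 2(X₁+X₂)²` and `S₂ = X₁² − X₂²`, for all complex matrices. -/
theorem stmt_19 (k : ℕ) (X₁ X₂ : Matrix (Fin k) (Fin k) ℂ) :
    (X₁ ^ 4 +
        (1 / 4 : ℂ) • (X₁ ^ 3 * X₂ + X₁ ^ 2 * X₂ * X₁ + X₁ * X₂ * X₁ ^ 2 + X₂ * X₁ ^ 3) +
        (1 / 6 : ℂ) • (X₁ ^ 2 * X₂ ^ 2 + X₁ * X₂ * X₁ * X₂ + X₁ * X₂ ^ 2 * X₁ +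
          X₂ * X₁ ^ 2 * X₂ + X₂ * X₁ * X₂ * X₁ + X₂ ^ 2 * X₁ ^ 2) +
        (1 / 4 : ℂ) • (X₁ * X₂ ^ 3 + X₂ * X₁ * X₂ ^ 2 + X₂ ^ 2 * X₁ * X₂ + X₂ ^ 3 * X₁) +
        X₂ ^ 4) -
      (5 / 12 : ℂ) • (X₁ ^ 4 + X₂ ^ 4) =
    (1 / 24 : ℂ) • (X₁ ^ 2 + X₂ ^ 2 + (2 : ℂ) • (X₁ + X₂) ^ 2) ^ 2 +
      (5 / 24 : ℂ) • (X₁ ^ 2 - X₂ ^ 2) ^ 2 := by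
  simp only [pow_succ, pow_zero, one_mul, mul_add, add_mul, mul_sub, sub_mul, smul_add,
    smul_mul_assoc, mul_smul_comm, ← mul_assoc]
  module
end
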